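/- (Sorting-induced bias: closed form.) Let s, δ, δ′ be mutually independent centered real Gaussian random variables with variances σ_s² ≥ 0, σ_δ² > 0, σ_δ² respectively, and let a < 0 be a constant. Define the signal error η = a·δ, the observed signal ŝ = s + η with σ_ŝ = √(σ_s² + a²σ_δ²), the return measurement error ε = δ′ − δ, and the noise share ρ = |a|·σ_δ/σ_ŝ. Let α ∈ (0,1) and let c_L, c_S be the real numbers with P(ŝ ≥ c_L) = α and P(ŝ ≤ c_S) = α. Then the long–short bias satisfies E[ε | ŝ ≥ c_L] − E[ε | ŝ ≤ c_S] = 2·κ(α)·ρ·σ_δ. -/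

import Mathlib

open MeasureTheory ProbabilityTheory Real

noncomputable section

/-- The standard normal density `φ(z) = (1/√(2π))·exp(−z²/2)`. -/
def stdNormalPDF (z : ℝ) : ℝ := (Real.sqrt (2 * Real.pi))⁻¹ * Real.exp (-z ^ 2 / 2)

/-- Conditional mean of `X` given an event `A`: `E[X | A] = E[X · 1_A] / P(A)`. -/
def condMean {Ω : Type*} [MeasurableSpace Ω] (μ : Measure Ω) (A : Set Ω) (X : Ω → ℝ) : ℝ :=
  (∫ ω in A, X ω ∂μ) / (μ A).toReal

/-- The antiderivative of `z φ(z)` is `-φ(z)`. -/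
lemma hasDerivAt_neg_stdNormalPDF (x : ℝ) :
    HasDerivAt (fun z => -stdNormalPDF z) (stdNormalPDF x * x) x := by
  have h : HasDerivAt (fun z : ℝ => -z ^ 2 / 2) (-x) x := by
    convert! ((hasDerivAt_pow 2 x).neg.div_const 2) using 1
    norm_num
    ring
  convert! ((h.exp.const_mul (Real.sqrt (2 * Real.pi))⁻¹).neg) using 1
  simp only [stdNormalPDF]
  ring

lemma gaussianPDFReal_zero_one (x : ℝ) : gaussianPDFReal 0 1 x = stdNormalPDF x := by
  simp [gaussianPDFReal, stdNormalPDF]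

lemma tendsto_stdNormalPDF_atBot : Filter.Tendsto stdNormalPDF Filter.atBot (nhds 0) := by
  have h : Filter.Tendsto (fun z : ℝ => -z ^ 2 / 2) Filter.atBot Filter.atBot := by
    have h2 : Filter.Tendsto (fun z : ℝ => z ^ 2 / 2) Filter.atBot Filter.atTop :=
      (Filter.tendsto_pow_atTop two_ne_zero |>.comp Filter.tendsto_neg_atBot_atTop
        |>.atTop_div_const two_pos).congr (by simp)
    exact (Filter.tendsto_neg_atTop_atBot.comp h2).congr (by intro z; simp [neg_div])
  rw [← mul_zero (Real.sqrt (2 * Real.pi))⁻¹]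
  exact (Real.tendsto_exp_atBot.comp h).const_mul _

/-- Lower partial expectation of a standard normal. -/
lemma setIntegral_Iic_id_gaussianReal (q : ℝ) :
    ∫ x in Set.Iic q, x ∂(gaussianReal 0 1) = -stdNormalPDF q := by
  have hint : Integrable (fun x : ℝ => stdNormalPDF x * x) := by
    have h : Integrable (fun x : ℝ => x) (gaussianReal 0 1) :=
      memLp_one_iff_integrable.1 (memLp_id_gaussianReal 1)
    rw [gaussianReal_of_var_ne_zero 0 one_ne_zero,
      integrable_withDensity_iff_integrable_smul' (by fun_prop)
        (Filter.Eventually.of_forall fun x => gaussianPDF_lt_top)] at h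
    simpa [gaussianPDFReal_zero_one] using h
  rw [← integral_indicator measurableSet_Iic,
    integral_gaussianReal_eq_integral_smul one_ne_zero]
  have h : (fun x : ℝ => gaussianPDFReal 0 1 x • (Set.Iic q).indicator (fun x => x) x)
      = (Set.Iic q).indicator (fun x => stdNormalPDF x * x) := by
    ext x
    by_cases hx : x ∈ Set.Iic q <;> simp [hx, gaussianPDFReal_zero_one]
  rw [h, integral_indicator measurableSet_Iic,
    integral_Iic_of_hasDerivAt_of_tendsto' (fun x _ => hasDerivAt_neg_stdNormalPDF x)
      hint.integrableOn tendsto_stdNormalPDF_atBot.neg]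
  simp

lemma map_neg_gaussianReal_zero_one :
    (gaussianReal 0 1).map (fun x => -x) = gaussianReal 0 1 := by
  simp [gaussianReal_map_neg]

/-- Upper partial expectation of a standard normal. -/
lemma setIntegral_Ici_id_gaussianReal (c : ℝ) :
    ∫ x in Set.Ici c, x ∂(gaussianReal 0 1) = stdNormalPDF (-c) := by
  rw [← map_neg_gaussianReal_zero_one,
    setIntegral_map measurableSet_Ici (by fun_prop) (by fun_prop)]
  have h : (fun x : ℝ => -x) ⁻¹' Set.Ici c = Set.Iic (-c) := by
    ext x
    simp
  rw [h, integral_neg, setIntegral_Iic_id_gaussianReal, neg_neg]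

lemma gaussianReal_real_Ici (c : ℝ) :
    (gaussianReal 0 1).real (Set.Ici c) = (gaussianReal 0 1).real (Set.Iic (-c)) := by
  conv_lhs => rw [← map_neg_gaussianReal_zero_one]
  rw [map_measureReal_apply (by fun_prop) measurableSet_Ici]
  congr 1
  ext x
  simp

lemma strictMono_gaussianReal_real_Iic :
    StrictMono fun x : ℝ => (gaussianReal 0 1).real (Set.Iic x) := by
  intro x y hxy
  have hpos : 0 < (gaussianReal 0 1).real (Set.Ioc x y) := by
    rw [measureReal_def, ENNReal.toReal_pos_iff]
    refine ⟨pos_iff_ne_zero.2 fun h => ?_, measure_lt_top _ _⟩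
    have := gaussianReal_absolutelyContinuous' 0 one_ne_zero h
    simp [hxy.not_ge] at this
  have hunion := measureReal_union (μ := gaussianReal 0 1)
    (Set.Iic_disjoint_Ioc (le_refl x) (c := y)) measurableSet_Ioc
  rw [Set.Iic_union_Ioc_eq_Iic hxy.le] at hunion
  simp only [hunion]
  linarith

/-- Gaussian regression: if `(Z, Y)` is centered Gaussian with `Var Z = 1`, then
`E[Y; Z ∈ B] = Cov(Z, Y) E[Z; Z ∈ B]`. -/
lemma setIntegral_preimage_of_hasGaussianLaw {Ω : Type*} [MeasurableSpace Ω] {μ : Measure Ω}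
    {Z Y : Ω → ℝ} (hZY : HasGaussianLaw (fun ω => (Z ω, Y ω)) μ) (hZm : Measurable Z)
    (hZ0 : ∫ ω, Z ω ∂μ = 0) (hY0 : ∫ ω, Y ω ∂μ = 0) (hvar : cov[Z, Z; μ] = 1)
    {B : Set ℝ} (hB : MeasurableSet B) :
    ∫ ω in Z ⁻¹' B, Y ω ∂μ = cov[Z, Y; μ] * ∫ ω in Z ⁻¹' B, Z ω ∂μ := by
  have := hZY.isProbabilityMeasure
  set b := cov[Z, Y; μ] with hb
  have hZ := hZY.fst
  have hY := hZY.snd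
  let R : Ω → ℝ := Y - b • Z
  have hZR : HasGaussianLaw (fun ω => (Z ω, R ω)) μ :=
    hZY.map ((ContinuousLinearMap.fst ℝ ℝ ℝ).prod
      (ContinuousLinearMap.snd ℝ ℝ ℝ - b • ContinuousLinearMap.fst ℝ ℝ ℝ))
  have hcov : cov[Z, R; μ] = 0 := by
    rw [covariance_sub_right hZ.memLp_two hY.memLp_two (hZ.memLp_two.const_smul b),
      covariance_smul_right, hvar, ← hb]
    ring
  have hR0 : ∫ ω, R ω ∂μ = 0 := by
    simp only [R, Pi.sub_apply, Pi.smul_apply, smul_eq_mul]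
    rw [integral_sub hY.integrable (hZ.integrable.const_mul b), integral_const_mul, hY0, hZ0]
    simp
  have hind : IndepFun Z R μ := hZR.indepFun_of_covariance_eq_zero hcov
  have hR : ∫ ω in Z ⁻¹' B, R ω ∂μ = 0 := by
    have hone : Measurable (B.indicator (fun _ => (1 : ℝ))) := measurable_const.indicator hB
    have h := (hind.comp hone measurable_id).integral_fun_mul_eq_mul_integral
      (hone.comp hZm).aestronglyMeasurable hZR.snd.aemeasurable.aestronglyMeasurable
    simp only [Function.id_comp, hR0, mul_zero] at h
    rw [← integral_indicator (hZm hB), ← h]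
    congr 1 with ω
    by_cases hω : Z ω ∈ B <;> simp [hω]
  have hdecomp : ∀ ω, Y ω = R ω + b * Z ω := fun ω => by simp [R]
  simp_rw [hdecomp]
  rw [integral_add hZR.snd.integrable.integrableOn (hZ.integrable.const_mul b).integrableOn, hR,
    integral_const_mul, zero_add]

/-- Sorting-induced bias, closed form: with `s`, `δ`, `δ′` mutually independent centered
Gaussians, signal error `η = a·δ` (`a < 0`), observed signal `ŝ = s + η`,
`σ_ŝ = √(σ_s² + a²σ_δ²)`, return error `ε = δ′ − δ`, noise share `ρ = |a|·σ_δ/σ_ŝ`, and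
`c_L`, `c_S` the upper/lower `α`-quantiles of `ŝ`, the long–short bias equals
`2·κ(α)·ρ·σ_δ` with `κ(α) = φ(Φ⁻¹(α))/α` (encoded via `Φ(q) = α`). -/
theorem sorting_induced_bias_closed_form
    {Ω : Type*} [MeasurableSpace Ω] (μ : Measure Ω) [IsProbabilityMeasure μ]
    (s δ δ' : Ω → ℝ) (hs : Measurable s) (hδ : Measurable δ) (hδ' : Measurable δ')
    (hindep : iIndepFun ![s, δ, δ'] μ)
    (σs2 σδ : ℝ) (hσs2 : 0 ≤ σs2) (hσδ : 0 < σδ)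
    (hslaw : μ.map s = gaussianReal 0 σs2.toNNReal)
    (hδlaw : μ.map δ = gaussianReal 0 ((σδ ^ 2).toNNReal))
    (hδ'law : μ.map δ' = gaussianReal 0 ((σδ ^ 2).toNNReal))
    (a : ℝ) (ha : a < 0)
    (shat ε : Ω → ℝ)
    (hshat : ∀ ω, shat ω = s ω + a * δ ω)
    (hεdef : ∀ ω, ε ω = δ' ω - δ ω)
    (σshat ρ : ℝ)
    (hσshat : σshat = Real.sqrt (σs2 + a ^ 2 * σδ ^ 2))
    (hρ : ρ = |a| * σδ / σshat)
    (α : ℝ) (hα : α ∈ Set.Ioo (0 : ℝ) 1)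
    (q : ℝ) (hq : cdf (gaussianReal 0 1) q = α)
    (cL cS : ℝ)
    (hcL : (μ {ω | cL ≤ shat ω}).toReal = α)
    (hcS : (μ {ω | shat ω ≤ cS}).toReal = α) :
    condMean μ {ω | cL ≤ shat ω} ε - condMean μ {ω | shat ω ≤ cS} ε
      = 2 * (stdNormalPDF q / α) * ρ * σδ := by
  have hv : 0 < σs2 + a ^ 2 * σδ ^ 2 := by
    have := mul_pos (pow_pos (neg_pos.2 ha) 2) (pow_pos hσδ 2)
    nlinarith
  have hσpos : 0 < σshat := hσshat ▸ Real.sqrt_pos.2 hv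
  have hσsq : σshat ^ 2 = σs2 + a ^ 2 * σδ ^ 2 := by rw [hσshat, Real.sq_sqrt hv.le]
  have gs : HasGaussianLaw s μ := ⟨hslaw ▸ inferInstance⟩
  have gδ : HasGaussianLaw δ μ := ⟨hδlaw ▸ inferInstance⟩
  have gδ' : HasGaussianLaw δ' μ := ⟨hδ'law ▸ inferInstance⟩
  have mean_of_law : ∀ {X : Ω → ℝ} {v : NNReal}, Measurable X → μ.map X = gaussianReal 0 v →
      ∫ ω, X ω ∂μ = 0 := by
    intro X v hX hlaw
    rw [← integral_map (f := fun x => x) hX.aemeasurable (by fun_prop), hlaw,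
      integral_id_gaussianReal]
  have cov_self_of_law : ∀ {X : Ω → ℝ} {v : NNReal}, Measurable X →
      μ.map X = gaussianReal 0 v → cov[X, X; μ] = v := by
    intro X v hX hlaw
    rw [covariance_self hX.aemeasurable, ← variance_id_map hX.aemeasurable, hlaw,
      variance_id_gaussianReal]
  have cov_ss : cov[s, s; μ] = σs2 := by
    rw [cov_self_of_law hs hslaw, Real.coe_toNNReal _ hσs2]
  have cov_δδ : cov[δ, δ; μ] = σδ ^ 2 := by
    rw [cov_self_of_law hδ hδlaw, Real.coe_toNNReal _ (sq_nonneg _)]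
  have cov_sδ : cov[s, δ; μ] = 0 :=
    (hindep.indepFun (i := 0) (j := 1) (by decide)).covariance_eq_zero gs.memLp_two gδ.memLp_two
  have cov_sδ' : cov[s, δ'; μ] = 0 :=
    (hindep.indepFun (i := 0) (j := 2) (by decide)).covariance_eq_zero gs.memLp_two gδ'.memLp_two
  have cov_δδ' : cov[δ, δ'; μ] = 0 :=
    (hindep.indepFun (i := 1) (j := 2) (by decide)).covariance_eq_zero gδ.memLp_two gδ'.memLp_two
  have hjoint : HasGaussianLaw (fun ω => (![s, δ, δ'] · ω)) μ :=
    hindep.hasGaussianLaw (fun i => by fin_cases i <;> assumption)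
  let Z : Ω → ℝ := σshat⁻¹ • (s + a • δ)
  have hZm : Measurable Z := (hs.add (hδ.const_smul a)).const_smul σshat⁻¹
  have hε : ε = δ' - δ := funext hεdef
  have hZY : HasGaussianLaw (fun ω => (Z ω, ε ω)) μ := by
    let p (i : Fin 3) : (Fin 3 → ℝ) →L[ℝ] ℝ := ContinuousLinearMap.proj i
    convert! hjoint.map ((σshat⁻¹ • (p 0 + a • p 1)).prod (p 2 - p 1)) using 1
    ext ω <;> simp [Z, hε, p]
  have hsum : MemLp (s + a • δ) 2 μ := gs.memLp_two.add (gδ.memLp_two.const_smul a)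
  have hvar : cov[Z, Z; μ] = 1 := by
    simp only [Z]
    rw [covariance_smul_left, covariance_smul_right,
      covariance_add_left gs.memLp_two (gδ.memLp_two.const_smul a) hsum,
      covariance_add_right gs.memLp_two gs.memLp_two (gδ.memLp_two.const_smul a),
      covariance_add_right (gδ.memLp_two.const_smul a) gs.memLp_two (gδ.memLp_two.const_smul a)]
    simp only [covariance_smul_left, covariance_smul_right]
    rw [covariance_comm δ s, cov_ss, cov_δδ, cov_sδ]
    field_simp
    linarith
  have hcov : cov[Z, ε; μ] = -a * σδ ^ 2 / σshat := by
    simp only [Z, hε]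
    rw [covariance_smul_left,
      covariance_sub_right hsum gδ'.memLp_two gδ.memLp_two,
      covariance_add_left gs.memLp_two (gδ.memLp_two.const_smul a) gδ'.memLp_two,
      covariance_add_left gs.memLp_two (gδ.memLp_two.const_smul a) gδ.memLp_two]
    simp only [covariance_smul_left]
    rw [cov_sδ, cov_sδ', cov_δδ', cov_δδ]
    field_simp
    ring
  have hZ0 : ∫ ω, Z ω ∂μ = 0 := by
    simp only [Z, Pi.smul_apply, Pi.add_apply, smul_eq_mul]
    rw [integral_const_mul, integral_add gs.integrable (gδ.integrable.const_mul a),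
      integral_const_mul, mean_of_law hs hslaw, mean_of_law hδ hδlaw]
    simp
  have hε0 : ∫ ω, ε ω ∂μ = 0 := by
    simp only [hεdef]
    rw [integral_sub gδ'.integrable gδ.integrable, mean_of_law hδ hδlaw, mean_of_law hδ' hδ'law,
      sub_zero]
  have hZlaw : μ.map Z = gaussianReal 0 1 := by
    rw [hZY.fst.map_eq_gaussianReal, hZ0, ← covariance_self hZm.aemeasurable, hvar,
      Real.toNNReal_one]
  have hZshat : ∀ ω, Z ω = shat ω / σshat := fun ω => by
    simp only [Z, Pi.smul_apply, Pi.add_apply, smul_eq_mul, hshat]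
    field_simp
  have hL : {ω | cL ≤ shat ω} = Z ⁻¹' Set.Ici (cL / σshat) := by
    ext ω
    simp [hZshat, div_le_div_iff_of_pos_right hσpos]
  have hS : {ω | shat ω ≤ cS} = Z ⁻¹' Set.Iic (cS / σshat) := by
    ext ω
    simp [hZshat, div_le_div_iff_of_pos_right hσpos]
  rw [cdf_eq_real] at hq
  have hqL : -(cL / σshat) = q := by
    apply strictMono_gaussianReal_real_Iic.injective
    simp only
    rw [hq, ← gaussianReal_real_Ici, ← hZlaw, map_measureReal_apply hZm measurableSet_Ici, ← hL]
    exact hcL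
  have hqS : cS / σshat = q := by
    apply strictMono_gaussianReal_real_Iic.injective
    simp only
    rw [hq, ← hZlaw, map_measureReal_apply hZm measurableSet_Iic, ← hS]
    exact hcS
  have partial_mean : ∀ {B : Set ℝ}, MeasurableSet B →
      ∫ ω in Z ⁻¹' B, ε ω ∂μ = -a * σδ ^ 2 / σshat * ∫ x in B, x ∂(gaussianReal 0 1) := by
    intro B hB
    rw [setIntegral_preimage_of_hasGaussianLaw hZY hZm hZ0 hε0 hvar hB, hcov, ← hZlaw,
      setIntegral_map hB (by fun_prop) hZm.aemeasurable]
  rw [condMean, condMean, hcL, hcS, hL, hS, partial_mean measurableSet_Ici,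
    partial_mean measurableSet_Iic, setIntegral_Ici_id_gaussianReal,
    setIntegral_Iic_id_gaussianReal, hqL, hqS, hρ, abs_of_neg ha]
  have hα0 : α ≠ 0 := hα.1.ne'
  field_simp
  ring

end
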